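/- arXiv:2307.05070 — 9 statements merged into one kernel-verified Lean document; each statement's English description precedes it below -/
import Mathlib

section
/- Axiom (A6) is valid: for every finite-choice kiobt-model M, every agent α, every formula φ of L_R, and every index ⟨m,h⟩, if M,⟨m,h⟩ ⊨ ⊙^S_αφ then M,⟨m,h⟩ ⊨ ⊙^S_α(K_αφ). -/
namespace IEAUST

variable {Agent Mom : Type}

/-- Histories: maximal chains of moments. -/
abbrev Hist (lt : Mom → Mom → Prop) : Type _ := {s : Set Mom // IsMaxChain lt s}

/-- An index is a pair of a moment and a history passing through it. -/
structure Idx (lt : Mom → Mom → Prop) where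
  mom : Mom
  hist : Hist lt
  mem : mom ∈ hist.val

/-- The ex ante information set of an agent at an index. -/
def exAnte {lt : Mom → Mom → Prop} (epi : Agent → Idx lt → Idx lt → Prop)
    (a : Agent) (i : Idx lt) : Set (Idx lt) :=
  {j | ∃ (h'' : Hist lt) (p : j.mom ∈ h''.val), epi a i ⟨j.mom, h'', p⟩}

/-- A kiobt structure: branching time, choices, epistemic relations, intention
topologies and deontic value(s). -/
structure KiobtModel (Agent Mom : Type) (lt : Mom → Mom → Prop) where
  ags_fin : Finite Agent
  mom_ne : Nonempty Mom
  lt_irrefl : ∀ m, ¬ lt m m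
  lt_trans : ∀ {m₁ m₂ m₃}, lt m₁ m₂ → lt m₂ m₃ → lt m₁ m₃
  no_bb : ∀ {m₁ m₂ m}, lt m₁ m → lt m₂ m → m₁ = m₂ ∨ lt m₁ m₂ ∨ lt m₂ m₁
  Choice : Agent → Mom → Set (Set (Hist lt))
  choice_sub : ∀ a m, ∀ L ∈ Choice a m, ∀ h ∈ L, m ∈ (h : Hist lt).val
  choice_ne : ∀ a m, ∀ L ∈ Choice a m, L.Nonempty
  choice_cover : ∀ a m (h : Hist lt), m ∈ h.val → ∃ L ∈ Choice a m, h ∈ L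
  choice_disj : ∀ a m, ∀ L ∈ Choice a m, ∀ L' ∈ Choice a m, ∀ h, h ∈ L → h ∈ L' → L = L'
  nc : ∀ a m m', lt m m' → ∀ h h' : Hist lt, m ∈ h.val → m ∈ h'.val →
        m' ∈ h.val → m' ∈ h'.val → ∀ L ∈ Choice a m, h ∈ L → h' ∈ L
  ia : ∀ m (s : Agent → Set (Hist lt)), (∀ a, s a ∈ Choice a m) → (⋂ a, s a).Nonempty
  epi : Agent → Idx lt → Idx lt → Prop
  epi_equiv : ∀ a, Equivalence (epi a)
  oac : ∀ a (i j : Idx lt), epi a i j → ∀ L ∈ Choice a i.mom, i.hist ∈ L →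
        ∀ h' ∈ L, ∀ p : i.mom ∈ (h' : Hist lt).val, epi a ⟨i.mom, h', p⟩ j
  unifH : ∀ a (i j : Idx lt), epi a i j → ∀ (h' : Hist lt) (p : i.mom ∈ h'.val),
        ∃ (h'' : Hist lt) (q : j.mom ∈ h''.val), epi a ⟨i.mom, h', p⟩ ⟨j.mom, h'', q⟩
  tau : Agent → Idx lt → Set (Set (Idx lt))
  tau_sub : ∀ a i, ∀ U ∈ tau a i, U ⊆ exAnte epi a i
  tau_univ : ∀ a i, exAnte epi a i ∈ tau a i
  tau_empty : ∀ a i, (∅ : Set (Idx lt)) ∈ tau a i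
  tau_inter : ∀ a i U V, U ∈ tau a i → V ∈ tau a i → U ∩ V ∈ tau a i
  tau_sUnion : ∀ a i (S : Set (Set (Idx lt))), S ⊆ tau a i → ⋃₀ S ∈ tau a i
  tau_ci : ∀ a i U V, U ∈ tau a i → V ∈ tau a i → U.Nonempty → V.Nonempty → (U ∩ V).Nonempty
  tau_ki : ∀ a i j, exAnte epi a i = exAnte epi a j → tau a i = tau a j
  Value : Hist lt → ℝ
  val : ℕ → Set (Idx lt)

variable {lt : Mom → Mom → Prop}

/-- The model is finite-choice if every choice partition has finitely many cells. -/
def FiniteChoice (M : KiobtModel Agent Mom lt) : Prop :=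
  ∀ a m, (M.Choice a m).Finite

/-- `State^m_β`. -/
def stateSet (M : KiobtModel Agent Mom lt) (b : Agent) (m : Mom) : Set (Set (Hist lt)) :=
  {S | ∃ s : Agent → Set (Hist lt), (∀ a, s a ∈ M.Choice a m) ∧
        S = ⋂ a ∈ {a : Agent | a ≠ b}, s a}

/-- `X ≤ Y` (ordering used for objective dominance). -/
def leVal (M : KiobtModel Agent Mom lt) (X Y : Set (Hist lt)) : Prop :=
  ∀ h ∈ X, ∀ h' ∈ Y, M.Value h ≤ M.Value h'

/-- `X ≤_s Y` (ordering used for subjective dominance). -/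
def leValS (M : KiobtModel Agent Mom lt) (X Y : Set (Hist lt)) : Prop :=
  ∀ h ∈ X, ∀ h' ∈ Y, M.Value h ≤ M.Value h'

/-- Objective dominance `L ≼ L'`. -/
def domO (M : KiobtModel Agent Mom lt) (a : Agent) (m : Mom) (L L' : Set (Hist lt)) : Prop :=
  ∀ S ∈ stateSet M a m, leVal M (L ∩ S) (L' ∩ S)

/-- Strict objective dominance `L ≺ L'`. -/
def sdomO (M : KiobtModel Agent Mom lt) (a : Agent) (m : Mom) (L L' : Set (Hist lt)) : Prop :=
  domO M a m L L' ∧ ¬ domO M a m L' L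

/-- `Optimal^m_α`. -/
def optimal (M : KiobtModel Agent Mom lt) (a : Agent) (m : Mom) : Set (Set (Hist lt)) :=
  {L | L ∈ M.Choice a m ∧ ¬ ∃ L' ∈ M.Choice a m, sdomO M a m L L'}

/-- `m ∼_α m'` for moments. -/
def momRel (M : KiobtModel Agent Mom lt) (a : Agent) (m m' : Mom) : Prop :=
  ∃ (i j : Idx lt), i.mom = m ∧ j.mom = m' ∧ M.epi a i j

/-- The epistemic cluster `[L]^m_α` of `L ⊆ H_{m*}` at `m`. -/
def cluster (M : KiobtModel Agent Mom lt) (a : Agent) (mstar : Mom)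
    (L : Set (Hist lt)) (m : Mom) : Set (Hist lt) :=
  {h | ∃ (p : m ∈ h.val) (hs : Hist lt), hs ∈ L ∧
        ∃ q : mstar ∈ hs.val, M.epi a ⟨mstar, hs, q⟩ ⟨m, h, p⟩}

/-- Subjective dominance `L ≼_s L'`. -/
def domS (M : KiobtModel Agent Mom lt) (a : Agent) (mstar : Mom)
    (L L' : Set (Hist lt)) : Prop :=
  ∀ m, momRel M a mstar m → ∀ S ∈ stateSet M a m,
    leValS M (cluster M a mstar L m ∩ S) (cluster M a mstar L' m ∩ S)

/-- Strict subjective dominance `L ≺_s L'`. -/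
def sdomS (M : KiobtModel Agent Mom lt) (a : Agent) (mstar : Mom)
    (L L' : Set (Hist lt)) : Prop :=
  domS M a mstar L L' ∧ ¬ domS M a mstar L' L

/-- `SOptimal^m_α`. -/
def soptimal (M : KiobtModel Agent Mom lt) (a : Agent) (m : Mom) : Set (Set (Hist lt)) :=
  {L | L ∈ M.Choice a m ∧ ¬ ∃ L' ∈ M.Choice a m, sdomS M a m L L'}

/-- Formulas of the language `L_R` (atomic propositions indexed by `ℕ`). -/
inductive Formula (Agent : Type) : Type
  | atom : ℕ → Formula Agent
  | neg : Formula Agent → Formula Agent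
  | conj : Formula Agent → Formula Agent → Formula Agent
  | box : Formula Agent → Formula Agent
  | stit : Agent → Formula Agent → Formula Agent
  | know : Agent → Formula Agent → Formula Agent
  | intend : Agent → Formula Agent → Formula Agent
  | oughtO : Agent → Formula Agent → Formula Agent
  | oughtS : Agent → Formula Agent → Formula Agent

/-- `◇φ := ¬□¬φ`. -/
def Formula.diam (φ : Formula Agent) : Formula Agent := .neg (.box (.neg φ))

/-- Material implication `φ → ψ := ¬(φ ∧ ¬ψ)`. -/
def Formula.imp (φ ψ : Formula Agent) : Formula Agent := .neg (.conj φ (.neg ψ))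

/-- Truth at an index of a (finite-choice) kiobt-model. -/
def truth (M : KiobtModel Agent Mom lt) : Formula Agent → Idx lt → Prop
  | .atom n, i => i ∈ M.val n
  | .neg φ, i => ¬ truth M φ i
  | .conj φ ψ, i => truth M φ i ∧ truth M ψ i
  | .box φ, i => ∀ (h' : Hist lt) (p : i.mom ∈ h'.val), truth M φ ⟨i.mom, h', p⟩
  | .stit a φ, i => ∀ L ∈ M.Choice a i.mom, i.hist ∈ L →
      ∀ h' ∈ L, ∀ p : i.mom ∈ (h' : Hist lt).val, truth M φ ⟨i.mom, h', p⟩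
  | .know a φ, i => ∀ j, M.epi a i j → truth M φ j
  | .intend a φ, i => ∃ U ∈ M.tau a i, U.Nonempty ∧ ∀ j ∈ U, truth M φ j
  | .oughtO a φ, i => ∀ L ∈ optimal M a i.mom, ∀ h' ∈ L,
      ∀ p : i.mom ∈ (h' : Hist lt).val, truth M φ ⟨i.mom, h', p⟩
  | .oughtS a φ, i => ∀ L ∈ soptimal M a i.mom, ∀ m', momRel M a i.mom m' →
      ∀ h' ∈ cluster M a i.mom L m', ∀ p : m' ∈ (h' : Hist lt).val, truth M φ ⟨m', h', p⟩

theorem a6_axiom_valid {Agent Mom : Type} {lt : Mom → Mom → Prop}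
    (M : KiobtModel Agent Mom lt) (hfc : FiniteChoice M)
    (a : Agent) (φ : Formula Agent) (i : Idx lt)
    (h : truth M (.oughtS a φ) i) :
    truth M (.oughtS a (.know a φ)) i := by
  intro L hL m' _ h' hh' p j hj
  obtain ⟨_, hs, hsL, q, hq⟩ := hh'
  have hij := (M.epi_equiv a).trans hq hj
  exact h L hL j.mom ⟨⟨i.mom, hs, q⟩, j, rfl, rfl, hij⟩ j.hist ⟨j.mem, hs, hsL, q, hij⟩ j.mem

end IEAUST
end

section
/- Axiom (SuN) is valid: for every finite-choice kiobt-model M, every agent α, every formula φ of L_R, and every index ⟨m,h⟩, if M,⟨m,h⟩ ⊨ K_α□φ then M,⟨m,h⟩ ⊨ ⊙^S_αφ. -/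
namespace IEAUST

variable {Agent Mom : Type}

variable {lt : Mom → Mom → Prop}

theorem suN_axiom_valid {Agent Mom : Type} {lt : Mom → Mom → Prop}
    (M : KiobtModel Agent Mom lt) (hfc : FiniteChoice M)
    (a : Agent) (φ : Formula Agent) (i : Idx lt)
    (h : truth M (.know a (.box φ)) i) :
    truth M (.oughtS a φ) i := by
  intro L _ m' _ h' ⟨p, hs, _, q, hepi⟩ p'
  obtain ⟨h'', q'', hepi'⟩ := M.unifH a ⟨i.mom, hs, q⟩ ⟨m', h', p⟩ hepi i.hist i.mem
  exact h ⟨m', h'', q''⟩ hepi' h' p'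

end IEAUST
end

section
/- Axiom (s.Oic) is valid: for every finite-choice kiobt-model M, every agent α, every formula φ of L_R, and every index ⟨m,h⟩, if M,⟨m,h⟩ ⊨ ⊙^S_αφ then M,⟨m,h⟩ ⊨ ◇K_αφ. -/
namespace IEAUST

variable {Agent Mom : Type}

variable {lt : Mom → Mom → Prop}

/-- The cluster of a choice cell at `mstar` meets every state at a moment
epistemically indistinguishable from `mstar`. -/
theorem cluster_inter_nonempty (M : KiobtModel Agent Mom lt) {a : Agent} {mstar m : Mom}
    {L S : Set (Hist lt)} (hL : L ∈ M.Choice a mstar) (hm : momRel M a mstar m)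
    (hS : S ∈ stateSet M a m) : (cluster M a mstar L m ∩ S).Nonempty := by
  classical
  obtain ⟨i, j, rfl, rfl, hij⟩ := hm
  obtain ⟨s, hs, rfl⟩ := hS
  obtain ⟨h₀, hh₀⟩ := M.choice_ne a _ L hL
  obtain ⟨h₁, q, hq⟩ := M.unifH a i j hij h₀ (M.choice_sub a _ L hL h₀ hh₀)
  obtain ⟨C, hC, h₁C⟩ := M.choice_cover a j.mom h₁ q
  obtain ⟨g, hg⟩ := M.ia j.mom (Function.update s a C) fun b => by
    rcases eq_or_ne b a with rfl | hb
    · simpa using hC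
    · simpa [hb] using hs b
  rw [Set.mem_iInter] at hg
  have hgC : g ∈ C := by simpa using hg a
  have hgj : j.mom ∈ g.val := M.choice_sub a _ C hC g hgC
  refine ⟨g, ⟨hgj, h₀, hh₀, M.choice_sub a _ L hL h₀ hh₀, ?_⟩, ?_⟩
  · exact (M.epi_equiv a).symm
      (M.oac a ⟨j.mom, h₁, q⟩ _ ((M.epi_equiv a).symm hq) C hC h₁C g hgC hgj)
  · refine Set.mem_iInter₂.2 fun b hb => ?_
    have hb' : b ≠ a := hb
    simpa [hb'] using hg b

theorem domS_trans (M : KiobtModel Agent Mom lt) {a : Agent} {m : Mom}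
    {L L' L'' : Set (Hist lt)} (hL' : L' ∈ M.Choice a m)
    (h : domS M a m L L') (h' : domS M a m L' L'') : domS M a m L L'' := by
  intro n hn S hS x hx z hz
  obtain ⟨y, hy⟩ := cluster_inter_nonempty M hL' hn hS
  exact (h n hn S hS x hx y hy).trans (h' n hn S hS y hy z hz)

theorem soptimal_nonempty (M : KiobtModel Agent Mom lt) {a : Agent} {m : Mom}
    (hfin : (M.Choice a m).Finite) (hne : (M.Choice a m).Nonempty) :
    (soptimal M a m).Nonempty := by
  have : Finite (M.Choice a m) := hfin
  let r : M.Choice a m → M.Choice a m → Prop := fun L L' => sdomS M a m L'.1 L.1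
  have : IsTrans _ r := ⟨fun _ L _ h h' =>
    ⟨domS_trans M L.2 h'.1 h.1, fun k => h.2 (domS_trans M (Subtype.property _) k h'.1)⟩⟩
  have : Std.Irrefl r := ⟨fun _ h => h.2 h.1⟩
  obtain ⟨L, -, hL⟩ := (Finite.wellFounded_of_trans_of_irrefl r).has_min Set.univ
    (hne.elim fun L hL => ⟨⟨L, hL⟩, trivial⟩)
  exact ⟨L, L.2, fun ⟨L', hL', h⟩ => hL ⟨L', hL'⟩ trivial h⟩

theorem sOic_axiom_valid {Agent Mom : Type} {lt : Mom → Mom → Prop}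
    (M : KiobtModel Agent Mom lt) (hfc : FiniteChoice M)
    (a : Agent) (φ : Formula Agent) (i : Idx lt)
    (h : truth M (.oughtS a φ) i) :
    truth M (Formula.diam (.know a φ)) i := by
  obtain ⟨C, hC, -⟩ := M.choice_cover a i.mom i.hist i.mem
  obtain ⟨L, hL⟩ := soptimal_nonempty M (hfc a i.mom) ⟨C, hC⟩
  obtain ⟨g, hg⟩ := M.choice_ne a _ L hL.1
  have hgi : i.mom ∈ g.val := M.choice_sub a _ L hL.1 g hg
  intro hbox
  exact hbox g hgi fun j hj =>
    h L hL j.mom ⟨⟨i.mom, g, hgi⟩, j, rfl, rfl, hj⟩ j.hist ⟨j.mem, g, hg, hgi, hj⟩ j.mem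

end IEAUST
end

section
/- Axiom (s.Cl) is valid: for every finite-choice kiobt-model M, every agent α, every formula φ of L_R, and every index ⟨m,h⟩, if M,⟨m,h⟩ ⊨ ⊙^S_αφ then M,⟨m,h⟩ ⊨ K_α□⊙^S_αφ. -/
namespace IEAUST

variable {Agent Mom : Type}

variable {lt : Mom → Mom → Prop}

theorem momRel_symm (M : KiobtModel Agent Mom lt) {a : Agent} {m n : Mom}
    (h : momRel M a m n) : momRel M a n m := by
  obtain ⟨i, j, hi, hj, e⟩ := h
  exact ⟨j, i, hj, hi, (M.epi_equiv a).symm e⟩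

theorem momRel_trans (M : KiobtModel Agent Mom lt) {a : Agent} {m n k : Mom}
    (h : momRel M a m n) (h' : momRel M a n k) : momRel M a m k := by
  obtain ⟨i, j, rfl, rfl, e⟩ := h
  obtain ⟨i', j', hi', rfl, e'⟩ := h'
  obtain ⟨g, q, e''⟩ := M.unifH a i' j' e' j.hist (hi' ▸ j.mem)
  obtain ⟨n, g', q'⟩ := i'
  cases hi'
  exact ⟨i, ⟨j'.mom, g, q⟩, rfl, rfl, (M.epi_equiv a).trans e e''⟩

/-- A choice cell lies in a single information set. -/
theorem epi_of_mem_choice (M : KiobtModel Agent Mom lt) {a : Agent} {m : Mom}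
    {L : Set (Hist lt)} (hL : L ∈ M.Choice a m) {h h' : Hist lt} (hh : h ∈ L) (hh' : h' ∈ L)
    (p : m ∈ h.val) (p' : m ∈ h'.val) : M.epi a ⟨m, h, p⟩ ⟨m, h', p'⟩ :=
  M.oac a ⟨m, h', p'⟩ ⟨m, h', p'⟩ ((M.epi_equiv a).refl _) L hL hh' h hh p

theorem cluster_subset_of_epi (M : KiobtModel Agent Mom lt) {a : Agent} {m n : Mom}
    {L L' : Set (Hist lt)} (hL : L ∈ M.Choice a m)
    {h h' : Hist lt} (hh : h ∈ L) (hh' : h' ∈ L') (p : m ∈ h.val) (p' : n ∈ h'.val)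
    (e : M.epi a ⟨m, h, p⟩ ⟨n, h', p'⟩) (k : Mom) :
    cluster M a m L k ⊆ cluster M a n L' k := by
  rintro g ⟨q, g', hg', q', e'⟩
  exact ⟨q, h', hh', p', (M.epi_equiv a).trans ((M.epi_equiv a).symm e)
    ((M.epi_equiv a).trans (epi_of_mem_choice M hL hh hg' p q') e')⟩

/-- Every choice cell has a counterpart with the same epistemic clusters at each
indistinguishable moment. -/
theorem exists_choice_cluster_eq (M : KiobtModel Agent Mom lt) {a : Agent} {m n : Mom}
    (hmn : momRel M a m n) {L : Set (Hist lt)} (hL : L ∈ M.Choice a m) :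
    ∃ L' ∈ M.Choice a n, cluster M a n L' = cluster M a m L := by
  obtain ⟨i, j, rfl, rfl, e⟩ := hmn
  obtain ⟨h, hh⟩ := M.choice_ne a _ L hL
  have p := M.choice_sub a _ L hL h hh
  obtain ⟨h', p', e'⟩ := M.unifH a i j e h p
  obtain ⟨L', hL', hh'⟩ := M.choice_cover a _ h' p'
  exact ⟨L', hL', funext fun k => Set.Subset.antisymm
    (cluster_subset_of_epi M hL' hh' hh p' p ((M.epi_equiv a).symm e') k)
    (cluster_subset_of_epi M hL hh hh' p p' e' k)⟩

/-- Subjective dominance depends only on the epistemic clusters. -/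
theorem domS_congr (M : KiobtModel Agent Mom lt) {a : Agent} {m n : Mom}
    (hmn : momRel M a m n) {K L K' L' : Set (Hist lt)}
    (hK : cluster M a n K' = cluster M a m K) (hL : cluster M a n L' = cluster M a m L) :
    domS M a n K' L' ↔ domS M a m K L := by
  have hrel (k : Mom) : momRel M a n k ↔ momRel M a m k :=
    ⟨momRel_trans M hmn, momRel_trans M (momRel_symm M hmn)⟩
  simp only [domS, hK, hL, hrel]

theorem mem_soptimal_of_cluster_eq (M : KiobtModel Agent Mom lt) {a : Agent} {m n : Mom}
    (hmn : momRel M a m n) {L L' : Set (Hist lt)} (hL : L ∈ soptimal M a m)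
    (hL' : L' ∈ M.Choice a n) (hc : cluster M a n L' = cluster M a m L) :
    L' ∈ soptimal M a n := by
  refine ⟨hL', ?_⟩
  rintro ⟨K', hK', hlt, hnlt⟩
  obtain ⟨K, hK, hcK⟩ := exists_choice_cluster_eq M (momRel_symm M hmn) hK'
  exact hL.2 ⟨K, hK, (domS_congr M hmn hc hcK.symm).1 hlt,
    fun hd => hnlt ((domS_congr M hmn hcK.symm hc).2 hd)⟩

theorem sCl_axiom_valid {Agent Mom : Type} {lt : Mom → Mom → Prop}
    (M : KiobtModel Agent Mom lt) (hfc : FiniteChoice M)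
    (a : Agent) (φ : Formula Agent) (i : Idx lt)
    (h : truth M (.oughtS a φ) i) :
    truth M (.know a (.box (.oughtS a φ))) i := by
  intro j e g q L hL n hn g' hg' p
  have hij : momRel M a i.mom j.mom := ⟨i, j, rfl, rfl, e⟩
  have hji := momRel_symm M hij
  obtain ⟨L', hL', hc⟩ := exists_choice_cluster_eq M hji hL.1
  exact h L' (mem_soptimal_of_cluster_eq M hji hL hL' hc) n (momRel_trans M hij hn) g'
    (hc ▸ hg') p

end IEAUST
end

section
/- Axiom (ConSO) is valid: for every finite-choice kiobt-model M, every agent α, every formula φ of L_R, and every index ⟨m,h⟩, if M,⟨m,h⟩ ⊨ ⊙^S_αφ then M,⟨m,h⟩ ⊭ ⊙_α¬φ. -/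
namespace IEAUST

variable {Agent Mom : Type}

variable {lt : Mom → Mom → Prop}

/-- In a finite set with a transitive relation, every element lies below a maximal one. -/
theorem exists_maximal_of_trans {β : Type*} {C : Set β} (hC : C.Finite) {r : β → β → Prop}
    (htrans : ∀ x ∈ C, ∀ y ∈ C, ∀ z ∈ C, r x y → r y z → r x z) {x : β} (hx : x ∈ C) :
    ∃ y ∈ C, (y = x ∨ r x y) ∧ ¬ ∃ z ∈ C, r y z ∧ ¬ r z y := by
  have : Finite C := hC
  let gt : C → C → Prop := fun y z => r z y ∧ ¬ r y z
  have : IsTrans C gt := ⟨fun u v w huv hvw =>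
    ⟨htrans w w.2 v v.2 u u.2 hvw.1 huv.1,
      fun huw => huv.2 (htrans u u.2 w w.2 v v.2 huw hvw.1)⟩⟩
  have : Std.Irrefl gt := ⟨fun u hu => hu.2 hu.1⟩
  have hwf : WellFounded gt := Finite.wellFounded_of_trans_of_irrefl gt
  suffices H : ∀ x : C, ∃ y ∈ C, (y = x ∨ r x y) ∧ ¬ ∃ z ∈ C, r y z ∧ ¬ r z y from H ⟨x, hx⟩
  intro x
  induction x using hwf.induction with
  | _ x ih =>
    by_cases hmax : ∃ z ∈ C, r x z ∧ ¬ r z x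
    · obtain ⟨z, hz, hxz⟩ := hmax
      obtain ⟨y, hy, hzy, hymax⟩ := ih ⟨z, hz⟩ hxz
      refine ⟨y, hy, Or.inr ?_, hymax⟩
      rcases hzy with rfl | hzy
      · exact hxz.1
      · exact htrans x x.2 z hz y hy hxz.1 hzy
    · exact ⟨x, x.2, Or.inl rfl, hmax⟩

/-- Every choice cell meets every state of the other agents. -/
theorem choice_inter_state_nonempty (M : KiobtModel Agent Mom lt) {a : Agent} {m : Mom}
    {L S : Set (Hist lt)} (hL : L ∈ M.Choice a m) (hS : S ∈ stateSet M a m) :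
    (L ∩ S).Nonempty := by
  classical
  obtain ⟨s, hs, rfl⟩ := hS
  obtain ⟨h, hh⟩ := M.ia m (Function.update s a L) (fun b => by
    by_cases hb : b = a
    · subst hb; simpa using hL
    · simpa [hb] using hs b)
  rw [Set.mem_iInter] at hh
  refine ⟨h, by simpa using hh a, Set.mem_iInter₂.2 fun b hb => ?_⟩
  have hb' : b ≠ a := hb
  simpa [hb'] using hh b

/-- The epistemic cluster of a choice cell at an indistinguishable moment contains a choice cell. -/
theorem exists_choice_subset_cluster (M : KiobtModel Agent Mom lt) {a : Agent} {m m' : Mom}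
    {L : Set (Hist lt)} (hL : L ∈ M.Choice a m) (hm : momRel M a m m') :
    ∃ L' ∈ M.Choice a m', L' ⊆ cluster M a m L m' := by
  obtain ⟨i, j, rfl, rfl, hij⟩ := hm
  obtain ⟨k, hk⟩ := M.choice_ne a _ L hL
  have hkm := M.choice_sub a _ L hL k hk
  obtain ⟨k', hk'm, he⟩ := M.unifH a i j hij k hkm
  obtain ⟨L', hL', hk'⟩ := M.choice_cover a j.mom k' hk'm
  refine ⟨L', hL', fun g hg => ?_⟩
  have hgm := M.choice_sub a _ L' hL' g hg
  exact ⟨hgm, k, hk, hkm, (M.epi_equiv a).symm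
    (M.oac a ⟨j.mom, k', hk'm⟩ _ ((M.epi_equiv a).symm he) L' hL' hk' g hg hgm)⟩

theorem subset_cluster_self (M : KiobtModel Agent Mom lt) {a : Agent} {m : Mom}
    {L : Set (Hist lt)} (hL : L ∈ M.Choice a m) : L ⊆ cluster M a m L m := fun g hg =>
  have hgm := M.choice_sub a m L hL g hg
  ⟨hgm, g, hg, hgm, (M.epi_equiv a).refl _⟩

theorem leVal_trans (M : KiobtModel Agent Mom lt) {X Y Z : Set (Hist lt)} (hY : Y.Nonempty)
    (hXY : leVal M X Y) (hYZ : leVal M Y Z) : leVal M X Z := fun x hx z hz =>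
  have ⟨y, hy⟩ := hY
  (hXY x hx y hy).trans (hYZ y hy z hz)

theorem domO_trans (M : KiobtModel Agent Mom lt) {a : Agent} {m : Mom} {L₁ L₂ L₃ : Set (Hist lt)}
    (hL₂ : L₂ ∈ M.Choice a m) (h₁₂ : domO M a m L₁ L₂) (h₂₃ : domO M a m L₂ L₃) :
    domO M a m L₁ L₃ := fun S hS =>
  leVal_trans M (choice_inter_state_nonempty M hL₂ hS) (h₁₂ S hS) (h₂₃ S hS)

theorem domS_trans_s6 (M : KiobtModel Agent Mom lt) {a : Agent} {m : Mom} {L₁ L₂ L₃ : Set (Hist lt)}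
    (hL₂ : L₂ ∈ M.Choice a m) (h₁₂ : domS M a m L₁ L₂) (h₂₃ : domS M a m L₂ L₃) :
    domS M a m L₁ L₃ := fun m' hm S hS =>
  have ⟨_, hL, hsub⟩ := exists_choice_subset_cluster M hL₂ hm
  leVal_trans M ((choice_inter_state_nonempty M hL hS).mono (Set.inter_subset_inter_left S hsub))
    (h₁₂ m' hm S hS) (h₂₃ m' hm S hS)

theorem momRel_self (M : KiobtModel Agent Mom lt) (a : Agent) (i : Idx lt) :
    momRel M a i.mom i.mom :=
  ⟨i, i, rfl, rfl, (M.epi_equiv a).refl i⟩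

theorem domO_of_domS (M : KiobtModel Agent Mom lt) {a : Agent} {m : Mom} {L L' : Set (Hist lt)}
    (hm : momRel M a m m) (hL : L ∈ M.Choice a m) (hL' : L' ∈ M.Choice a m)
    (hdom : domS M a m L L') : domO M a m L L' := fun S hS x hx y hy =>
  hdom m hm S hS x ⟨subset_cluster_self M hL hx.1, hx.2⟩ y ⟨subset_cluster_self M hL' hy.1, hy.2⟩

theorem optimal_of_domO (M : KiobtModel Agent Mom lt) {a : Agent} {m : Mom} {L L' : Set (Hist lt)}
    (hL : L ∈ optimal M a m) (hL' : L' ∈ M.Choice a m) (hdom : domO M a m L L') :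
    L' ∈ optimal M a m := by
  refine ⟨hL', fun ⟨K, hK, hL'K, hKL'⟩ => hL.2 ⟨K, hK, ?_, fun hKL => hKL' ?_⟩⟩
  · exact domO_trans M hL' hdom hL'K
  · exact domO_trans M hL.1 hKL hdom

/-- In a finite-choice model some choice cell is both objectively and subjectively optimal. -/
theorem optimal_inter_soptimal_nonempty (M : KiobtModel Agent Mom lt) (hfc : FiniteChoice M)
    (a : Agent) (i : Idx lt) : (optimal M a i.mom ∩ soptimal M a i.mom).Nonempty := by
  obtain ⟨L₀, hL₀, -⟩ := M.choice_cover a i.mom i.hist i.mem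
  obtain ⟨L, hL, -, hLmax⟩ := exists_maximal_of_trans (hfc a i.mom) (r := domO M a i.mom)
    (fun _ _ _ hy _ _ => domO_trans M hy) hL₀
  obtain ⟨K, hK, hLK, hKmax⟩ := exists_maximal_of_trans (hfc a i.mom) (r := domS M a i.mom)
    (fun _ _ _ hy _ _ => domS_trans_s6 M hy) hL
  have hLopt : L ∈ optimal M a i.mom := ⟨hL, hLmax⟩
  refine ⟨K, ?_, hK, hKmax⟩
  rcases hLK with rfl | hLK
  · exact hLopt
  · exact optimal_of_domO M hLopt hK (domO_of_domS M (momRel_self M a i) hL hK hLK)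

theorem conSO_axiom_valid {Agent Mom : Type} {lt : Mom → Mom → Prop}
    (M : KiobtModel Agent Mom lt) (hfc : FiniteChoice M)
    (a : Agent) (φ : Formula Agent) (i : Idx lt)
    (h : truth M (.oughtS a φ) i) :
    ¬ truth M (.oughtO a (.neg φ)) i := by
  obtain ⟨L, hLopt, hLsopt⟩ := optimal_inter_soptimal_nonempty M hfc a i
  obtain ⟨g, hg⟩ := M.choice_ne a i.mom L hLopt.1
  have hgm := M.choice_sub a i.mom L hLopt.1 g hg
  intro hO
  exact hO L hLopt g hg hgm
    (h L hLsopt i.mom (momRel_self M a i) g (subset_cluster_self M hLopt.1 hg) hgm)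

end IEAUST
end

section
/- Axiom (InN) is valid: for every finite-choice kiobt-model M, every agent α, every formula φ of L_R, and every index ⟨m,h⟩, if M,⟨m,h⟩ ⊨ □K_αφ then M,⟨m,h⟩ ⊨ I_αφ. -/
namespace IEAUST

variable {Agent Mom : Type}

variable {lt : Mom → Mom → Prop}

theorem inN_axiom_valid {Agent Mom : Type} {lt : Mom → Mom → Prop}
    (M : KiobtModel Agent Mom lt) (hfc : FiniteChoice M)
    (a : Agent) (φ : Formula Agent) (i : Idx lt)
    (h : truth M (.box (.know a φ)) i) :
    truth M (.intend a φ) i := by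
  refine ⟨exAnte M.epi a i, M.tau_univ a i, ⟨i, i.hist, i.mem, (M.epi_equiv a).refl i⟩, ?_⟩
  rintro j ⟨h₁, p, hij⟩
  obtain ⟨h₂, q, hji⟩ := M.unifH a _ _ ((M.epi_equiv a).symm hij) j.hist j.mem
  exact h h₂ q j ((M.epi_equiv a).symm hji)

end IEAUST
end

section
/- Axiom (KI) is valid: for every finite-choice kiobt-model M, every agent α, every formula φ of L_R, and every index ⟨m,h⟩, if M,⟨m,h⟩ ⊨ I_αφ then M,⟨m,h⟩ ⊨ □K_αI_αφ. -/
namespace IEAUST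

variable {Agent Mom : Type}

variable {lt : Mom → Mom → Prop}

theorem exAnte_subset_of_mom_eq (M : KiobtModel Agent Mom lt) (a : Agent) {i j : Idx lt}
    (hij : i.mom = j.mom) : exAnte M.epi a i ⊆ exAnte M.epi a j := by
  obtain ⟨m, h, hm⟩ := i
  obtain ⟨m', h', hm'⟩ := j
  obtain rfl : m = m' := hij
  rintro k ⟨g, hg, hk⟩
  exact M.unifH a _ _ hk h' hm'

theorem exAnte_subset_of_epi (M : KiobtModel Agent Mom lt) (a : Agent) {i j : Idx lt}
    (hij : M.epi a i j) : exAnte M.epi a i ⊆ exAnte M.epi a j := by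
  rintro k ⟨g, hg, hk⟩
  exact ⟨g, hg, (M.epi_equiv a).trans ((M.epi_equiv a).symm hij) hk⟩

theorem ki_axiom_valid {Agent Mom : Type} {lt : Mom → Mom → Prop}
    (M : KiobtModel Agent Mom lt) (hfc : FiniteChoice M)
    (a : Agent) (φ : Formula Agent) (i : Idx lt)
    (h : truth M (.intend a φ) i) :
    truth M (.box (.know a (.intend a φ))) i := by
  intro h' p j hj
  have htau : M.tau a i = M.tau a j := M.tau_ki a i j <| Set.Subset.antisymm
    ((exAnte_subset_of_mom_eq M a (i := i) (j := ⟨i.mom, h', p⟩) rfl).trans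
      (exAnte_subset_of_epi M a hj))
    ((exAnte_subset_of_epi M a ((M.epi_equiv a).symm hj)).trans
      (exAnte_subset_of_mom_eq M a (i := ⟨i.mom, h', p⟩) (j := i) rfl))
  obtain ⟨U, hU, hne, hφ⟩ := h
  exact ⟨U, htau ▸ hU, hne, hφ⟩

end IEAUST
end

section
/- Axiom (Oic) is valid: for every finite-choice kiobt-model M, every agent α, every formula φ of L_R, and every index ⟨m,h⟩, if M,⟨m,h⟩ ⊨ ⊙_αφ then M,⟨m,h⟩ ⊨ ◇[α]φ. -/
namespace IEAUST

variable {Agent Mom : Type}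

variable {lt : Mom → Mom → Prop}

theorem domO_trans_s11 (M : KiobtModel Agent Mom lt) {a : Agent} {m : Mom}
    {L L' L'' : Set (Hist lt)} (hL' : L' ∈ M.Choice a m)
    (h₁ : domO M a m L L') (h₂ : domO M a m L' L'') : domO M a m L L'' := by
  intro S hS h hh h'' hh''
  obtain ⟨h', hh'⟩ := choice_inter_state_nonempty M hL' hS
  exact (h₁ S hS h hh h' hh').trans (h₂ S hS h' hh' h'' hh'')

theorem sdomO_trans (M : KiobtModel Agent Mom lt) {a : Agent} {m : Mom}
    {L L' L'' : Set (Hist lt)} (hL : L ∈ M.Choice a m) (hL' : L' ∈ M.Choice a m)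
    (h₁ : sdomO M a m L L') (h₂ : sdomO M a m L' L'') : sdomO M a m L L'' :=
  ⟨domO_trans_s11 M hL' h₁.1 h₂.1, fun h => h₂.2 (domO_trans_s11 M hL h h₁.1)⟩

/-- With finitely many choices at a moment, some choice is optimal. -/
theorem optimal_nonempty (M : KiobtModel Agent Mom lt) {a : Agent} {m : Mom}
    (hfin : (M.Choice a m).Finite) (hne : (M.Choice a m).Nonempty) :
    (optimal M a m).Nonempty := by
  have : Finite (M.Choice a m) := hfin
  let r : M.Choice a m → M.Choice a m → Prop := fun L' L => sdomO M a m L L'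
  have : IsTrans _ r := ⟨fun L'' L' L h₁ h₂ => sdomO_trans M L.2 L'.2 h₂ h₁⟩
  have : Std.Irrefl r := ⟨fun _ h => h.2 h.1⟩
  obtain ⟨L, -, hL⟩ := (Finite.wellFounded_of_trans_of_irrefl r).has_min Set.univ
    ⟨⟨_, hne.some_mem⟩, trivial⟩
  exact ⟨L, L.2, fun ⟨L', hL', h⟩ => hL ⟨L', hL'⟩ trivial h⟩

theorem oic_axiom_valid {Agent Mom : Type} {lt : Mom → Mom → Prop}
    (M : KiobtModel Agent Mom lt) (hfc : FiniteChoice M)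
    (a : Agent) (φ : Formula Agent) (i : Idx lt)
    (h : truth M (.oughtO a φ) i) :
    truth M (Formula.diam (.stit a φ)) i := by
  obtain ⟨L₀, hL₀, -⟩ := M.choice_cover a i.mom i.hist i.mem
  obtain ⟨L, hL⟩ := optimal_nonempty M (hfc a i.mom) ⟨L₀, hL₀⟩
  obtain ⟨h₁, hh₁⟩ := M.choice_ne a i.mom L hL.1
  intro hbox
  refine hbox h₁ (M.choice_sub a i.mom L hL.1 h₁ hh₁) fun L' hL' hmem h' hh' p => ?_
  obtain rfl := M.choice_disj a i.mom L hL.1 L' hL' h₁ hh₁ hmem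
  exact h L hL h' hh' p

end IEAUST
end

section
/- Active responsibility implies passive responsibility for all three categories: for every finite-choice kiobt-model M, every agent α, every formula φ of L_R, and every index ⟨m,h⟩: (causal) if M,⟨m,h⟩ ⊨ [α]φ ∧ ◇[α]¬φ then M,⟨m,h⟩ ⊨ φ ∧ ◇[α]¬φ; (informational) if M,⟨m,h⟩ ⊨ K_α[α]φ ∧ ◇K_α[α]¬φ then M,⟨m,h⟩ ⊨ φ ∧ K_α¬[α]¬φ ∧ ◇K_α[α]¬φ; (motivational) if M,⟨m,h⟩ ⊨ K_α[α]φ ∧ I_α[α]φ ∧ ◇K_α[α]¬φ then M,⟨m,h⟩ ⊨ φ ∧ K_α¬[α]¬φ ∧ I_α¬[α]¬φ ∧ ◇K_α[α]¬φ. -/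
namespace IEAUST

variable {Agent Mom : Type}

variable {lt : Mom → Mom → Prop}

theorem truth_of_stit (M : KiobtModel Agent Mom lt) {a : Agent} {φ : Formula Agent} {i : Idx lt}
    (h : truth M (.stit a φ) i) : truth M φ i := by
  obtain ⟨L, hL, hi⟩ := M.choice_cover a i.mom i.hist i.mem
  exact h L hL hi i.hist hi i.mem

theorem not_stit_neg_of_stit (M : KiobtModel Agent Mom lt) {a : Agent} {φ : Formula Agent}
    {i : Idx lt} (h : truth M (.stit a φ) i) : truth M (.neg (.stit a (.neg φ))) i :=
  fun hn => truth_of_stit M hn (truth_of_stit M h)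

/-- active responsibility implies passive responsibility, for the
causal, informational and motivational categories. -/
theorem active_implies_passive {Agent Mom : Type} {lt : Mom → Mom → Prop}
    (M : KiobtModel Agent Mom lt) (hfc : FiniteChoice M)
    (a : Agent) (φ : Formula Agent) (i : Idx lt) :
    (truth M (.conj (.stit a φ) (Formula.diam (.stit a (.neg φ)))) i →
      truth M (.conj φ (Formula.diam (.stit a (.neg φ)))) i) ∧
    (truth M (.conj (.know a (.stit a φ))
        (Formula.diam (.know a (.stit a (.neg φ))))) i →
      truth M (.conj φ (.conj (.know a (.neg (.stit a (.neg φ))))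
        (Formula.diam (.know a (.stit a (.neg φ)))))) i) ∧
    (truth M (.conj (.know a (.stit a φ)) (.conj (.intend a (.stit a φ))
        (Formula.diam (.know a (.stit a (.neg φ)))))) i →
      truth M (.conj φ (.conj (.know a (.neg (.stit a (.neg φ))))
        (.conj (.intend a (.neg (.stit a (.neg φ))))
          (Formula.diam (.know a (.stit a (.neg φ))))))) i) := by
  refine ⟨fun ⟨hs, hd⟩ => ⟨truth_of_stit M hs, hd⟩, fun ⟨hk, hd⟩ => ?_,
    fun ⟨hk, ⟨U, hU, hne, hUφ⟩, hd⟩ => ?_⟩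
  · exact ⟨truth_of_stit M (hk i ((M.epi_equiv a).refl i)),
      fun j hj => not_stit_neg_of_stit M (hk j hj), hd⟩
  · exact ⟨truth_of_stit M (hk i ((M.epi_equiv a).refl i)),
      fun j hj => not_stit_neg_of_stit M (hk j hj),
      ⟨U, hU, hne, fun j hj => not_stit_neg_of_stit M (hUφ j hj)⟩, hd⟩

end IEAUST
end
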